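/- The Schouten bracket of the Lie–Poisson bivector P on e*(3) with the deformed bivector P_d vanishes: [[P, P_d]] = 0, i.e. the two Poisson structures are compatible (any linear combination P + λ P_d is Poisson). -/

import Mathlib

open Matrix Filter

noncomputable section

/-- Index type for the phase space ℝ³×ℝ³: `Sum.inl` indexes γ, `Sum.inr` indexes M. -/
abbrev Idx : Type := Fin 3 ⊕ Fin 3

/-- The phase space ℝ⁶ of the variables (γ, M). -/
abbrev V : Type := Idx → ℝ

/-- The totally antisymmetric Levi-Civita symbol on `Fin 3` with ε₀₁₂ = 1. -/
def eps (i j k : Fin 3) : ℝ :=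
  (((i : ℕ) : ℝ) - ((j : ℕ) : ℝ)) * (((j : ℕ) : ℝ) - ((k : ℕ) : ℝ)) *
    (((k : ℕ) : ℝ) - ((i : ℕ) : ℝ)) / 2

def gI (i : Fin 3) : Idx := Sum.inl i
def mI (i : Fin 3) : Idx := Sum.inr i

/-- The γ-part of a phase point. -/
def gPart (x : V) : Fin 3 → ℝ := fun i => x (gI i)

/-- The M-part of a phase point. -/
def mPart (x : V) : Fin 3 → ℝ := fun i => x (mI i)

/-- Partial derivative of `f` at `x` in the coordinate direction `a`. -/
def pd (f : V → ℝ) (x : V) (a : Idx) : ℝ := fderiv ℝ f x (Pi.single a 1)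

/-- Bracket with structure functions `{M_i,M_j} = Σ_k ε_{ijk}·cM x k`,
`{M_i,γ_j} = Σ_k ε_{ijk}·cG x k`, `{γ_i,γ_j} = 0`, extended to functions
via partial derivatives. -/
def bracket (cM cG : V → Fin 3 → ℝ) (f g : V → ℝ) (x : V) : ℝ :=
  ∑ i : Fin 3, ∑ j : Fin 3, ∑ k : Fin 3, eps i j k *
    (cM x k * pd f x (mI i) * pd g x (mI j)
      + cG x k * (pd f x (mI i) * pd g x (gI j) + pd f x (gI i) * pd g x (mI j)))

/-- Structure functions of the standard Lie–Poisson bracket on e*(3). -/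
def cMstd (x : V) : Fin 3 → ℝ := mPart x

def cGstd (x : V) : Fin 3 → ℝ := gPart x

/-- A = diag(a₁,a₂,a₃). -/
def Amat (a₁ a₂ a₃ : ℝ) : Matrix (Fin 3) (Fin 3) ℝ := Matrix.diagonal ![a₁, a₂, a₃]

/-- g(γ) = (1 − d⟨γ,Aγ⟩)⁻¹. -/
def gfun (a₁ a₂ a₃ d : ℝ) (x : V) : ℝ :=
  (1 - d * (gPart x ⬝ᵥ (Amat a₁ a₂ a₃).mulVec (gPart x)))⁻¹

/-- √g(γ). -/
def sg (a₁ a₂ a₃ d : ℝ) (x : V) : ℝ := Real.sqrt (gfun a₁ a₂ a₃ d x)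

/-- ⟨M, Aγ⟩. -/
def MAg (a₁ a₂ a₃ : ℝ) (x : V) : ℝ := mPart x ⬝ᵥ (Amat a₁ a₂ a₃).mulVec (gPart x)

/-- The antisymmetric matrix of z ∈ ℝ³ with Z₁₂ = z₃, Z₂₃ = z₁, Z₃₁ = z₂. -/
def hatm (z : Fin 3 → ℝ) : Matrix (Fin 3) (Fin 3) ℝ :=
  !![0, z 2, -z 1; -z 2, 0, z 0; z 1, -z 0, 0]

/-- The Lie–Poisson bivector P on e*(3) in block form (0, Γ; Γ, 𝐌). -/
def Pstd (x : V) : Matrix Idx Idx ℝ :=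
  Matrix.fromBlocks 0 (hatm (gPart x)) (hatm (gPart x)) (hatm (mPart x))

/-- The deformed bivector P_d = (1/√g)(0,Γ;Γ,𝐌) − d√g⟨M,Aγ⟩(0,0;0,Γ). -/
def Pdef (a₁ a₂ a₃ d : ℝ) (x : V) : Matrix Idx Idx ℝ :=
  (sg a₁ a₂ a₃ d x)⁻¹ • Pstd x
    - (d * sg a₁ a₂ a₃ d x * MAg a₁ a₂ a₃ x) •
        Matrix.fromBlocks 0 0 0 (hatm (gPart x))

/-- The Schouten bracket of two bivectors (as a trivector):
[[R,Q]]^{ijk} = −Σ_m (Q^{mk}∂_m R^{ij} + R^{mk}∂_m Q^{ij} + cyclic(i,j,k)). -/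
def schouten (R Q : V → Matrix Idx Idx ℝ) (x : V) (i j k : Idx) : ℝ :=
  -(∑ m : Idx,
      (Q x m k * pd (fun y => R y i j) x m + R x m k * pd (fun y => Q y i j) x m
        + Q x m i * pd (fun y => R y j k) x m + R x m i * pd (fun y => Q y j k) x m
        + Q x m j * pd (fun y => R y k i) x m + R x m j * pd (fun y => Q y k i) x m))

theorem pd_mul {f g : V → ℝ} {x : V} (hf : DifferentiableAt ℝ f x)
    (hg : DifferentiableAt ℝ g x) (m : Idx) :
    pd (fun y => f y * g y) x m = pd f x m * g x + f x * pd g x m := by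
  simp only [pd, fderiv_fun_mul hf hg, _root_.add_apply,
    _root_.smul_apply, smul_eq_mul]
  ring

theorem pd_sub {f g : V → ℝ} {x : V} (hf : DifferentiableAt ℝ f x)
    (hg : DifferentiableAt ℝ g x) (m : Idx) :
    pd (fun y => f y - g y) x m = pd f x m - pd g x m := by
  simp only [pd, fderiv_fun_sub hf hg, _root_.sub_apply]

/-- A partial derivative of a linear function is its value on the basis vector. -/
theorem pd_linear {f : V → ℝ} (hf : IsLinearMap ℝ f) (x : V) (m : Idx) :
    pd f x m = f (Pi.single m 1) := by
  have h : HasFDerivAt f (LinearMap.toContinuousLinearMap hf.mk') x :=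
    (LinearMap.toContinuousLinearMap hf.mk').hasFDerivAt
  rw [pd, h.fderiv]
  rfl

theorem differentiableAt_of_isLinearMap {f : V → ℝ} (hf : IsLinearMap ℝ f) (x : V) :
    DifferentiableAt ℝ f x :=
  (LinearMap.toContinuousLinearMap hf.mk').differentiableAt

/-- The bivector with blocks (0, 0; 0, Γ). -/
def Pgamma (x : V) : Matrix Idx Idx ℝ :=
  Matrix.fromBlocks 0 0 0 (hatm (gPart x))

theorem hatm_add (z w : Fin 3 → ℝ) : hatm (z + w) = hatm z + hatm w := by
  ext i j
  fin_cases i <;> fin_cases j <;> simp [hatm] <;> ring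

theorem hatm_smul (c : ℝ) (z : Fin 3 → ℝ) : hatm (c • z) = c • hatm z := by
  ext i j
  fin_cases i <;> fin_cases j <;> simp [hatm]

theorem gPart_add (x y : V) : gPart (x + y) = gPart x + gPart y := rfl

theorem mPart_add (x y : V) : mPart (x + y) = mPart x + mPart y := rfl

theorem gPart_smul (c : ℝ) (x : V) : gPart (c • x) = c • gPart x := rfl

theorem mPart_smul (c : ℝ) (x : V) : mPart (c • x) = c • mPart x := rfl

theorem isLinearMap_Pstd (i j : Idx) : IsLinearMap ℝ fun y => Pstd y i j where
  map_add x y := by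
    rcases i with i | i <;> rcases j with j | j <;>
      simp [Pstd, gPart_add, mPart_add, hatm_add]
  map_smul c x := by
    rcases i with i | i <;> rcases j with j | j <;>
      simp [Pstd, gPart_smul, mPart_smul, hatm_smul]

theorem isLinearMap_Pgamma (i j : Idx) : IsLinearMap ℝ fun y => Pgamma y i j where
  map_add x y := by
    rcases i with i | i <;> rcases j with j | j <;>
      simp [Pgamma, gPart_add, hatm_add]
  map_smul c x := by
    rcases i with i | i <;> rcases j with j | j <;>
      simp [Pgamma, gPart_smul, hatm_smul]

theorem hasFDerivAt_coord (b : Idx) (x : V) :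
    HasFDerivAt (fun y : V => y b) (ContinuousLinearMap.proj (R := ℝ) b) x :=
  (ContinuousLinearMap.proj (R := ℝ) (φ := fun _ : Idx => ℝ) b).hasFDerivAt

theorem dotProduct_Amat_mulVec (a₁ a₂ a₃ : ℝ) (z w : Fin 3 → ℝ) :
    z ⬝ᵥ (Amat a₁ a₂ a₃).mulVec w = a₁ * z 0 * w 0 + a₂ * z 1 * w 1 + a₃ * z 2 * w 2 := by
  simp [Amat, Matrix.mulVec_diagonal, dotProduct, Fin.sum_univ_three]
  ring

/-- The components of (Aγ, 0), one half of the gradient of ⟨γ, Aγ⟩. -/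
def gradQuad (a₁ a₂ a₃ : ℝ) (x : V) : V :=
  Sum.elim ((Amat a₁ a₂ a₃).mulVec (gPart x)) 0

/-- The components of (AM, Aγ), the gradient of ⟨M, Aγ⟩. -/
def gradMAg (a₁ a₂ a₃ : ℝ) (x : V) : V :=
  Sum.elim ((Amat a₁ a₂ a₃).mulVec (mPart x)) ((Amat a₁ a₂ a₃).mulVec (gPart x))

theorem differentiable_MAg (a₁ a₂ a₃ : ℝ) : Differentiable ℝ (MAg a₁ a₂ a₃) := by
  unfold MAg
  simp only [dotProduct_Amat_mulVec, gPart, mPart]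
  fun_prop

theorem differentiable_quad (a₁ a₂ a₃ d : ℝ) :
    Differentiable ℝ fun y : V =>
      1 - d * (gPart y ⬝ᵥ (Amat a₁ a₂ a₃).mulVec (gPart y)) := by
  simp only [dotProduct_Amat_mulVec, gPart]
  fun_prop

theorem pd_MAg (a₁ a₂ a₃ : ℝ) (x : V) (m : Idx) :
    pd (MAg a₁ a₂ a₃) x m = gradMAg a₁ a₂ a₃ x m := by
  have h (b : Idx) := hasFDerivAt_coord b x
  have H := ((((h (mI 0)).const_mul a₁).mul (h (gI 0))).add
    (((h (mI 1)).const_mul a₂).mul (h (gI 1)))).add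
    (((h (mI 2)).const_mul a₃).mul (h (gI 2)))
  have e : MAg a₁ a₂ a₃ = fun y : V => a₁ * y (mI 0) * y (gI 0) + a₂ * y (mI 1) * y (gI 1)
      + a₃ * y (mI 2) * y (gI 2) := by
    funext y
    simp only [MAg, dotProduct_Amat_mulVec, gPart, mPart]
  rw [pd, e]
  erw [H.fderiv]
  rcases m with m | m <;> fin_cases m <;>
    simp [gradMAg, Amat, Matrix.mulVec_diagonal, gI, mI, gPart, mPart, mul_comm]

theorem pd_quad (a₁ a₂ a₃ d : ℝ) (x : V) (m : Idx) :
    pd (fun y => 1 - d * (gPart y ⬝ᵥ (Amat a₁ a₂ a₃).mulVec (gPart y))) x m =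
      -2 * d * gradQuad a₁ a₂ a₃ x m := by
  have h (b : Idx) := hasFDerivAt_coord b x
  have H := (((((h (gI 0)).const_mul a₁).mul (h (gI 0))).add
    (((h (gI 1)).const_mul a₂).mul (h (gI 1)))).add
    (((h (gI 2)).const_mul a₃).mul (h (gI 2)))).const_mul d |>.const_sub 1
  simp only [dotProduct_Amat_mulVec, gPart]
  rw [pd]
  erw [H.fderiv]
  rcases m with m | m <;> fin_cases m <;>
    simp [gradQuad, Amat, Matrix.mulVec_diagonal, gI, gPart] <;> ring

theorem sg_eq (a₁ a₂ a₃ d : ℝ) (x : V) :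
    sg a₁ a₂ a₃ d x =
      (√(1 - d * (gPart x ⬝ᵥ (Amat a₁ a₂ a₃).mulVec (gPart x))))⁻¹ := by
  rw [sg, gfun, Real.sqrt_inv]

section Derivatives

variable {a₁ a₂ a₃ d : ℝ} {x : V}

theorem hasFDerivAt_sg_inv
    (hx : 0 < 1 - d * (gPart x ⬝ᵥ (Amat a₁ a₂ a₃).mulVec (gPart x))) :
    HasFDerivAt (fun y => (sg a₁ a₂ a₃ d y)⁻¹)
      ((1 / (2 * (sg a₁ a₂ a₃ d x)⁻¹)) • fderiv ℝ (fun y : V =>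
        1 - d * (gPart y ⬝ᵥ (Amat a₁ a₂ a₃).mulVec (gPart y))) x) x := by
  simp only [sg_eq, inv_inv]
  exact (differentiable_quad a₁ a₂ a₃ d x).hasFDerivAt.sqrt hx.ne'

theorem sg_pos (hx : 0 < 1 - d * (gPart x ⬝ᵥ (Amat a₁ a₂ a₃).mulVec (gPart x))) :
    0 < sg a₁ a₂ a₃ d x :=
  Real.sqrt_pos.2 (inv_pos.2 hx)

theorem pd_sg_inv (hx : 0 < 1 - d * (gPart x ⬝ᵥ (Amat a₁ a₂ a₃).mulVec (gPart x)))
    (m : Idx) :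
    pd (fun y => (sg a₁ a₂ a₃ d y)⁻¹) x m =
      -d * sg a₁ a₂ a₃ d x * gradQuad a₁ a₂ a₃ x m := by
  have h := pd_quad a₁ a₂ a₃ d x m
  rw [pd] at h
  rw [pd, (hasFDerivAt_sg_inv hx).fderiv, _root_.smul_apply, h, smul_eq_mul]
  have := (sg_pos hx).ne'
  field_simp

theorem differentiableAt_sg
    (hx : 0 < 1 - d * (gPart x ⬝ᵥ (Amat a₁ a₂ a₃).mulVec (gPart x))) :
    DifferentiableAt ℝ (sg a₁ a₂ a₃ d) x := by
  simpa using (hasFDerivAt_sg_inv hx).differentiableAt.fun_inv (inv_ne_zero (sg_pos hx).ne')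

theorem pd_sg (hx : 0 < 1 - d * (gPart x ⬝ᵥ (Amat a₁ a₂ a₃).mulVec (gPart x)))
    (m : Idx) :
    pd (sg a₁ a₂ a₃ d) x m = d * sg a₁ a₂ a₃ d x ^ 3 * gradQuad a₁ a₂ a₃ x m := by
  have hs := (sg_pos hx).ne'
  have h := pd_sg_inv hx m
  have H := (hasDerivAt_inv (inv_ne_zero hs)).comp_hasFDerivAt x
    (hasFDerivAt_sg_inv hx).differentiableAt.hasFDerivAt
  have e : sg a₁ a₂ a₃ d = (fun t => t⁻¹) ∘ fun y => (sg a₁ a₂ a₃ d y)⁻¹ := by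
    funext y
    simp
  rw [pd] at h
  rw [pd, e, H.fderiv, _root_.smul_apply, h, ← e, smul_eq_mul]
  field_simp

theorem pd_Pdef (hx : 0 < 1 - d * (gPart x ⬝ᵥ (Amat a₁ a₂ a₃).mulVec (gPart x)))
    (i j m : Idx) :
    pd (fun y => Pdef a₁ a₂ a₃ d y i j) x m =
      -d * sg a₁ a₂ a₃ d x * gradQuad a₁ a₂ a₃ x m * Pstd x i j
        + (sg a₁ a₂ a₃ d x)⁻¹ * Pstd (Pi.single m 1) i j
        - (d * (d * sg a₁ a₂ a₃ d x ^ 3 * gradQuad a₁ a₂ a₃ x m * MAg a₁ a₂ a₃ x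
              + sg a₁ a₂ a₃ d x * gradMAg a₁ a₂ a₃ x m) * Pgamma x i j
            + d * sg a₁ a₂ a₃ d x * MAg a₁ a₂ a₃ x * Pgamma (Pi.single m 1) i j) := by
  have hu := (hasFDerivAt_sg_inv hx).differentiableAt
  have hs := differentiableAt_sg hx
  have hM := differentiable_MAg a₁ a₂ a₃ x
  have hP := differentiableAt_of_isLinearMap (isLinearMap_Pstd i j) x
  have hC := differentiableAt_of_isLinearMap (isLinearMap_Pgamma i j) x
  have hds : DifferentiableAt ℝ (fun y => d * sg a₁ a₂ a₃ d y) x := hs.const_mul d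
  have hc : pd (fun _ : V => d) x m = 0 := by simp [pd]
  change pd (fun y => (sg a₁ a₂ a₃ d y)⁻¹ * Pstd y i j
    - d * sg a₁ a₂ a₃ d y * MAg a₁ a₂ a₃ y * Pgamma y i j) x m = _
  rw [pd_sub (hu.fun_mul hP) ((hds.fun_mul hM).fun_mul hC), pd_mul hu hP, pd_mul (hds.fun_mul hM) hC,
    pd_mul hds hM, pd_mul (differentiableAt_const d) hs, hc, pd_sg_inv hx, pd_sg hx, pd_MAg,
    pd_linear (isLinearMap_Pstd i j), pd_linear (isLinearMap_Pgamma i j)]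
  ring

end Derivatives

/-- Contraction of the Lie–Poisson bivector with a covector. -/
def hamVec (x v : V) (k : Idx) : ℝ := ∑ m, Pstd x m k * v m

theorem hamVec_gradQuad (a₁ a₂ a₃ : ℝ) (x : V) :
    hamVec x (gradQuad a₁ a₂ a₃ x) =
      Sum.elim (0 : Fin 3 → ℝ) (gPart x ⨯₃ ((Amat a₁ a₂ a₃).mulVec (gPart x))) := by
  ext k
  rcases k with k | k <;> fin_cases k <;>
    simp [hamVec, Pstd, hatm, gradQuad, Fin.sum_univ_three, crossProduct] <;> ring

theorem hamVec_gradMAg (a₁ a₂ a₃ : ℝ) (x : V) :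
    hamVec x (gradMAg a₁ a₂ a₃ x) =
      Sum.elim (gPart x ⨯₃ ((Amat a₁ a₂ a₃).mulVec (gPart x)))
        ((gPart x ⨯₃ ((Amat a₁ a₂ a₃).mulVec (mPart x))) +
          (mPart x ⨯₃ ((Amat a₁ a₂ a₃).mulVec (gPart x)))) := by
  ext k
  rcases k with k | k <;> fin_cases k <;>
    simp [hamVec, Pstd, hatm, gradMAg, Fin.sum_univ_three, crossProduct] <;> ring

theorem hatm_zero : hatm 0 = 0 := by
  simpa using hatm_smul 0 0

/-- The Jacobi identity of so(3). -/
theorem jacobi_hatm (z : Fin 3 → ℝ) (i j k : Fin 3) :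
    ∑ m, (hatm z m k * hatm (Pi.single m 1) i j + hatm z m i * hatm (Pi.single m 1) j k
      + hatm z m j * hatm (Pi.single m 1) k i) = 0 := by
  fin_cases i <;> fin_cases j <;> fin_cases k <;> simp [hatm, Fin.sum_univ_three]

theorem gPart_single_inl (m : Fin 3) : gPart (Pi.single (Sum.inl m) 1) = Pi.single m 1 := by
  ext i
  simp [gPart, gI, Pi.single_apply]

theorem gPart_single_inr (m : Fin 3) : gPart (Pi.single (Sum.inr m) 1) = 0 := by
  ext i
  simp [gPart, gI]

theorem mPart_single_inl (m : Fin 3) : mPart (Pi.single (Sum.inl m) 1) = 0 := by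
  ext i
  simp [mPart, mI]

theorem mPart_single_inr (m : Fin 3) : mPart (Pi.single (Sum.inr m) 1) = Pi.single m 1 := by
  ext i
  simp [mPart, mI, Pi.single_apply]

theorem jacobi_Pstd (x : V) (i j k : Idx) :
    ∑ m, (Pstd x m k * Pstd (Pi.single m 1) i j + Pstd x m i * Pstd (Pi.single m 1) j k
      + Pstd x m j * Pstd (Pi.single m 1) k i) = 0 := by
  rcases i with i | i <;> rcases j with j | j <;> rcases k with k | k <;>
    have hg := jacobi_hatm (gPart x) i j k <;>
    have hm := jacobi_hatm (mPart x) i j k <;>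
    simp only [Finset.sum_add_distrib] at hg hm <;>
    simp [Pstd, gPart_single_inl, gPart_single_inr, mPart_single_inl, mPart_single_inr,
      hatm_zero, Finset.sum_add_distrib] <;>
    first
    | linear_combination hg
    | linear_combination 2 * hg
    | linear_combination hm

/-- The Lie–Poisson bivector is compatible with the bivector (0, 0; 0, Γ). -/
theorem jacobi_Pstd_Pgamma (x : V) (i j k : Idx) :
    ∑ m, (Pgamma x m k * Pstd (Pi.single m 1) i j + Pstd x m k * Pgamma (Pi.single m 1) i j
      + Pgamma x m i * Pstd (Pi.single m 1) j k + Pstd x m i * Pgamma (Pi.single m 1) j k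
      + Pgamma x m j * Pstd (Pi.single m 1) k i + Pstd x m j * Pgamma (Pi.single m 1) k i)
      = 0 := by
  rcases i with i | i <;> rcases j with j | j <;> rcases k with k | k <;>
    have hg := jacobi_hatm (gPart x) i j k <;>
    simp only [Finset.sum_add_distrib] at hg <;>
    simp [Pstd, Pgamma, gPart_single_inl, gPart_single_inr, mPart_single_inl, mPart_single_inr,
      hatm_zero, Finset.sum_add_distrib] <;>
    first
    | linear_combination hg
    | linear_combination 2 * hg

theorem hamVec_gradQuad_wedge_Pgamma (a₁ a₂ a₃ : ℝ) (x : V) (i j k : Idx) :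
    hamVec x (gradQuad a₁ a₂ a₃ x) k * Pgamma x i j
      + hamVec x (gradQuad a₁ a₂ a₃ x) i * Pgamma x j k
      + hamVec x (gradQuad a₁ a₂ a₃ x) j * Pgamma x k i = 0 := by
  rw [hamVec_gradQuad]
  rcases i with i | i <;> rcases j with j | j <;> rcases k with k | k <;>
    simp only [Pgamma, Matrix.fromBlocks_apply₁₁, Matrix.fromBlocks_apply₁₂,
      Matrix.fromBlocks_apply₂₁, Matrix.fromBlocks_apply₂₂, Sum.elim_inl, Sum.elim_inr,
      Matrix.zero_apply, Pi.zero_apply, mul_zero, zero_mul, add_zero]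
  fin_cases i <;> fin_cases j <;> fin_cases k <;> simp [hatm, crossProduct] <;> ring

theorem hamVec_wedge_cancel (a₁ a₂ a₃ : ℝ) (x : V) (i j k : Idx) :
    hamVec x (gradQuad a₁ a₂ a₃ x) k * Pstd x i j
      + hamVec x (gradQuad a₁ a₂ a₃ x) i * Pstd x j k
      + hamVec x (gradQuad a₁ a₂ a₃ x) j * Pstd x k i
      + (hamVec x (gradMAg a₁ a₂ a₃ x) k * Pgamma x i j
        + hamVec x (gradMAg a₁ a₂ a₃ x) i * Pgamma x j k
        + hamVec x (gradMAg a₁ a₂ a₃ x) j * Pgamma x k i) = 0 := by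
  rw [hamVec_gradQuad, hamVec_gradMAg]
  rcases i with i | i <;> rcases j with j | j <;> rcases k with k | k <;>
    simp only [Pstd, Pgamma, Matrix.fromBlocks_apply₁₁, Matrix.fromBlocks_apply₁₂,
      Matrix.fromBlocks_apply₂₁, Matrix.fromBlocks_apply₂₂, Sum.elim_inl, Sum.elim_inr,
      Matrix.zero_apply, Pi.zero_apply, mul_zero, zero_mul, add_zero] <;>
    fin_cases i <;> fin_cases j <;> fin_cases k <;> simp [hatm, crossProduct] <;> ring

/-- [[P, P_d]] = 0, i.e. the Lie–Poisson bivector and its nonholonomic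
deformation are compatible. -/
theorem schouten_compatibility (a₁ a₂ a₃ d : ℝ) (x : V)
    (hx : 0 < 1 - d * (gPart x ⬝ᵥ (Amat a₁ a₂ a₃).mulVec (gPart x)))
    (i j k : Idx) :
    schouten Pstd (Pdef a₁ a₂ a₃ d) x i j k = 0 := by
  have hP (i j m : Idx) := pd_linear (isLinearMap_Pstd i j) x m
  have hQ (i j : Idx) : Pdef a₁ a₂ a₃ d x i j = (sg a₁ a₂ a₃ d x)⁻¹ * Pstd x i j
      - d * sg a₁ a₂ a₃ d x * MAg a₁ a₂ a₃ x * Pgamma x i j := rfl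
  simp only [schouten, pd_Pdef hx, hP, hQ]
  have h₁ := jacobi_Pstd x i j k
  have h₂ := jacobi_Pstd_Pgamma x i j k
  have h₃ := hamVec_gradQuad_wedge_Pgamma a₁ a₂ a₃ x i j k
  have h₄ := hamVec_wedge_cancel a₁ a₂ a₃ x i j k
  simp only [hamVec, Fintype.sum_sum_type, Fin.sum_univ_three] at h₁ h₂ h₃ h₄ ⊢
  generalize (sg a₁ a₂ a₃ d x)⁻¹ = u
  linear_combination -2 * u * h₁ + d * sg a₁ a₂ a₃ d x * MAg a₁ a₂ a₃ x * h₂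
    + d ^ 2 * sg a₁ a₂ a₃ d x ^ 3 * MAg a₁ a₂ a₃ x * h₃ + d * sg a₁ a₂ a₃ d x * h₄
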